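/- Let q̄_n denote the number of quasi-Stirling permutations of the multiset [n,n] avoiding both patterns 132 and 213. Then q̄_1 = 1, q̄_2 = 4, q̄_3 = 11, and for every n ≥ 4 one has q̄_n = 3·q̄_{n−1} − q̄_{n−3} (equivalently, the generating function of q̄_n is (1−x)²/(1−3x+x³)). -/

import Mathlib

/-- `π : Fin (2*n) → Fin n` encodes a permutation of the multiset
`{1,1,2,2,…,n,n}`: every value appears exactly twice. -/
def IsMultisetPerm (n : ℕ) (π : Fin (2 * n) → Fin n) : Prop :=
  ∀ v : Fin n, Nat.card {i : Fin (2 * n) // π i = v} = 2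

/-- `π` avoids the pattern 1212. -/
def Avoids1212 (n : ℕ) (π : Fin (2 * n) → Fin n) : Prop :=
  ¬ ∃ i j k l : Fin (2 * n), i < j ∧ j < k ∧ k < l ∧
      π i = π k ∧ π j = π l ∧ π i < π j

/-- `π` avoids the pattern 2121. -/
def Avoids2121 (n : ℕ) (π : Fin (2 * n) → Fin n) : Prop :=
  ¬ ∃ i j k l : Fin (2 * n), i < j ∧ j < k ∧ k < l ∧
      π i = π k ∧ π j = π l ∧ π j < π i

/-- A quasi-Stirling permutation: a permutation of the multiset `[n,n]`
avoiding both 1212 and 2121. -/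
def IsQuasiStirling (n : ℕ) (π : Fin (2 * n) → Fin n) : Prop :=
  IsMultisetPerm n π ∧ Avoids1212 n π ∧ Avoids2121 n π

/-- `π` contains the length-3 pattern `σ` (with distinct entries):
there are positions `i₁ < i₂ < i₃` whose values are in the same relative
order as `σ`. -/
def Contains3 (n : ℕ) (σ : Fin 3 → ℕ) (π : Fin (2 * n) → Fin n) : Prop :=
  ∃ f : Fin 3 → Fin (2 * n), StrictMono f ∧
    ∀ a b : Fin 3, π (f a) < π (f b) ↔ σ a < σ b

/-- `π` avoids the length-3 pattern `σ`. -/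
def Avoids3 (n : ℕ) (σ : Fin 3 → ℕ) (π : Fin (2 * n) → Fin n) : Prop :=
  ¬ Contains3 n σ π

/-- The number of quasi-Stirling permutations of `[n,n]` avoiding both
132 and 213. -/
noncomputable def qbar132213 (n : ℕ) : ℕ :=
  Nat.card {π : Fin (2 * n) → Fin n //
    IsQuasiStirling n π ∧ Avoids3 n ![1, 3, 2] π ∧ Avoids3 n ![2, 1, 3] π}

def doubled (k : ℕ) : ℕ → List ℕ
  | 0 => []
  | m + 1 => k :: k :: doubled (k + 1) m

theorem count_doubled (k m v : ℕ) :
    (doubled k m).count v = if k ≤ v ∧ v < k + m then 2 else 0 := by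
  induction m generalizing k with
  | zero => simp [doubled]
  | succ m ih =>
    simp only [doubled, List.count_cons, ih, beq_iff_eq]
    grind

theorem mem_doubled {k m v : ℕ} : v ∈ doubled k m ↔ k ≤ v ∧ v < k + m := by
  rw [← List.count_pos_iff, count_doubled]
  grind

theorem length_doubled (k m : ℕ) : (doubled k m).length = 2 * m := by
  induction m generalizing k with
  | zero => rfl
  | succ m ih => simp [doubled, ih]; ring

theorem pairwise_doubled (k m : ℕ) : (doubled k m).Pairwise (· ≤ ·) := by
  induction m generalizing k with
  | zero => simp [doubled]
  | succ m ih =>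
    simp only [doubled, List.pairwise_cons, List.mem_cons, mem_doubled, ih]
    grind

theorem three_sublist_append {α : Type*} {a b c : α} {X Y : List α} (h : [a, b, c].Sublist (X ++ Y)) :
    [a, b, c].Sublist X ∨ ([a, b].Sublist X ∧ c ∈ Y) ∨ (a ∈ X ∧ [b, c].Sublist Y) ∨
      [a, b, c].Sublist Y := by
  obtain ⟨l₁, l₂, h, h₁, h₂⟩ := List.sublist_append_iff.1 h
  rcases l₁ with _ | ⟨x, _ | ⟨y, _ | ⟨z, l⟩⟩⟩ <;> simp at h <;> grind

/-- The word `l` avoids the patterns 132, 213, 1212 and 2121. -/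
structure AvoidsAll (l : List ℕ) : Prop where
  no132 : ∀ a b c, a < b → b < c → ¬ [a, c, b].Sublist l
  no213 : ∀ a b c, a < b → b < c → ¬ [b, a, c].Sublist l
  nocross : ∀ a b, a ≠ b → ¬ [a, b, a, b].Sublist l

theorem four_sublist_append {α : Type*} {a b c d : α} {X Y : List α}
    (h : [a, b, c, d].Sublist (X ++ Y)) :
    [a, b, c, d].Sublist X ∨ ([a, b, c].Sublist X ∧ d ∈ Y) ∨ ([a, b].Sublist X ∧ [c, d].Sublist Y) ∨
      (a ∈ X ∧ [b, c, d].Sublist Y) ∨ [a, b, c, d].Sublist Y := by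
  obtain ⟨l₁, l₂, h, h₁, h₂⟩ := List.sublist_append_iff.1 h
  rcases l₁ with _ | ⟨x, _ | ⟨y, _ | ⟨z, _ | ⟨w, l⟩⟩⟩⟩ <;> simp at h <;> grind

theorem le_of_pair_sublist {l : List ℕ} (hl : l.Pairwise (· ≤ ·)) {a b : ℕ}
    (h : [a, b].Sublist l) : a ≤ b := by
  simpa using hl.sublist h

theorem AvoidsAll.sublist {l l' : List ℕ} (h : AvoidsAll l) (hs : l'.Sublist l) : AvoidsAll l' where
  no132 a b c h₁ h₂ h₃ := h.no132 a b c h₁ h₂ (h₃.trans hs)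
  no213 a b c h₁ h₂ h₃ := h.no213 a b c h₁ h₂ (h₃.trans hs)
  nocross a b h₁ h₃ := h.nocross a b h₁ (h₃.trans hs)

theorem AvoidsAll.of_pairwise {l : List ℕ} (hl : l.Pairwise (· ≤ ·)) : AvoidsAll l where
  no132 a b c h₁ h₂ h₃ := by
    have := hl.sublist h₃
    simp at this
    omega
  no213 a b c h₁ h₂ h₃ := by
    have := hl.sublist h₃
    simp at this
    omega
  nocross a b h₁ h₃ := by
    have := hl.sublist h₃
    simp at this
    omega

theorem AvoidsAll.cons_of_pairwise {h : ℕ} {l : List ℕ} (hl : l.Pairwise (· ≤ ·))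
    (hh : ∀ a ∈ l, a ≤ h) : AvoidsAll (h :: l) where
  no132 a b c h₁ h₂ h₃ := by
    rcases List.cons_sublist_cons'.1 h₃ with h₃ | ⟨rfl, h₀⟩
    · exact (AvoidsAll.of_pairwise hl).no132 a b c h₁ h₂ h₃
    · have := hh c (h₀.subset (by simp))
      omega
  no213 a b c h₁ h₂ h₃ := by
    rcases List.cons_sublist_cons'.1 h₃ with h₃ | ⟨rfl, h₀⟩
    · exact (AvoidsAll.of_pairwise hl).no213 a b c h₁ h₂ h₃
    · have := hh c (h₀.subset (by simp))
      omega
  nocross a b h₁ h₃ := by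
    rcases List.cons_sublist_cons'.1 h₃ with h₃ | ⟨rfl, h₀⟩
    · exact (AvoidsAll.of_pairwise hl).nocross a b h₁ h₃
    · have := hl.sublist h₀
      simp at this
      omega

theorem AvoidsAll.append {X C : List ℕ} (hX : AvoidsAll X) (hC : AvoidsAll C)
    (h : ∀ x ∈ X, ∀ c ∈ C, c < x) : AvoidsAll (X ++ C) where
  no132 a b c h₁ h₂ h₃ := by
    rcases three_sublist_append h₃ with h₃ | ⟨h₃, h₄⟩ | ⟨h₃, h₄⟩ | h₃
    · exact hX.no132 a b c h₁ h₂ h₃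
    · have := h a (h₃.subset (by simp)) b h₄
      omega
    · have := h a h₃ b (h₄.subset (by simp))
      omega
    · exact hC.no132 a b c h₁ h₂ h₃
  no213 a b c h₁ h₂ h₃ := by
    rcases three_sublist_append h₃ with h₃ | ⟨h₃, h₄⟩ | ⟨h₃, h₄⟩ | h₃
    · exact hX.no213 a b c h₁ h₂ h₃
    · have := h b (h₃.subset (by simp)) c h₄
      omega
    · have := h b h₃ c (h₄.subset (by simp))
      omega
    · exact hC.no213 a b c h₁ h₂ h₃
  nocross a b h₁ h₃ := by
    rcases four_sublist_append h₃ with h₃ | ⟨h₃, h₄⟩ | ⟨h₃, h₄⟩ | ⟨h₃, h₄⟩ | h₃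
    · exact hX.nocross a b h₁ h₃
    · have := h b (h₃.subset (by simp)) b h₄
      omega
    · have := h a (h₃.subset (by simp)) a (h₄.subset (by simp))
      omega
    · have := h a h₃ a (h₄.subset (by simp))
      omega
    · exact hC.nocross a b h₁ h₃

theorem AvoidsAll.insert_after_head {k : ℕ} {X C : List ℕ} (hX : X.Pairwise (· ≤ ·))
    (hC : AvoidsAll (k :: C)) (hXk : ∀ x ∈ X, k < x) (hCk : ∀ c ∈ C, c ≤ k) :
    AvoidsAll (k :: (X ++ C)) := by
  have hXC : AvoidsAll (X ++ C) :=
    (AvoidsAll.of_pairwise hX).append (hC.sublist (List.sublist_cons_self k C))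
      fun x hx c hc => (hCk c hc).trans_lt (hXk x hx)
  refine ⟨fun a b c h₁ h₂ h₃ => ?_, fun a b c h₁ h₂ h₃ => ?_, fun a b h₁ h₃ => ?_⟩
  · rcases List.cons_sublist_cons'.1 h₃ with h₃ | ⟨rfl, h₀⟩
    · exact hXC.no132 a b c h₁ h₂ h₃
    · obtain ⟨l₁, l₂, h, h₃, h₄⟩ := List.sublist_append_iff.1 h₀
      have hb : b ∉ C := fun hb => by have := hCk b hb; omega
      have hc : c ∉ C := fun hb => by have := hCk c hb; omega
      have h₅ : l₂ = [] := List.eq_nil_iff_forall_not_mem.2 fun x hx => by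
        have h₅ : x ∈ [c, b] := h ▸ List.mem_append_right l₁ hx
        have h₆ := h₄.subset hx
        grind
      subst h₅
      rw [List.append_nil] at h
      subst h
      have := le_of_pair_sublist hX h₃
      omega
  · rcases List.cons_sublist_cons'.1 h₃ with h₃ | ⟨rfl, h₀⟩
    · exact hXC.no213 a b c h₁ h₂ h₃
    · have ha : a ∉ X := fun ha => by have := hXk a ha; omega
      have hc : c ∉ C := fun hb => by have := hCk c hb; omega
      obtain ⟨l₁, l₂, h, h₃, h₄⟩ := List.sublist_append_iff.1 h₀
      rcases l₁ with _ | ⟨x, l₁⟩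
      · simp only [List.nil_append] at h
        subst h
        exact hc (h₄.subset (by simp))
      · simp only [List.cons_append, List.cons.injEq] at h
        exact ha (h.1 ▸ h₃.subset (by simp))
  · rcases List.cons_sublist_cons'.1 h₃ with h₃ | ⟨rfl, h₀⟩
    · exact hXC.nocross a b h₁ h₃
    · have ha : a ∉ X := fun ha => by have := hXk a ha; omega
      rcases three_sublist_append h₀ with h₃ | ⟨h₃, h₄⟩ | ⟨h₃, h₄⟩ | h₃
      · exact ha (h₃.subset (by simp))
      · exact ha (h₃.subset (by simp))
      · have := hXk b h₃
        have := hCk b (h₄.subset (by simp))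
        omega
      · exact hC.nocross a b h₁ (List.cons_sublist_cons.2 h₃)

/-- `l` is a word in which each of `0, …, n - 1` occurs twice, avoiding 132, 213, 1212, 2121. -/
def IsGood (n : ℕ) (l : List ℕ) : Prop :=
  (∀ v, l.count v = if v < n then 2 else 0) ∧ AvoidsAll l

theorem IsGood.mem_iff {n : ℕ} {l : List ℕ} (h : IsGood n l) {v : ℕ} : v ∈ l ↔ v < n := by
  rw [← List.count_pos_iff, h.1]
  grind

theorem IsGood.length_eq {n : ℕ} {l : List ℕ} (h : IsGood n l) : l.length = 2 * n := by
  have : l.Perm (doubled 0 n) := List.perm_iff_count.2 fun v => by simp [h.1, count_doubled]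
  rw [this.length_eq, length_doubled]

theorem eq_of_pairwise_of_count {l l' : List ℕ} (h : l.Pairwise (· ≤ ·)) (h' : l'.Pairwise (· ≤ ·))
    (hc : ∀ v, l.count v = l'.count v) : l = l' :=
  (List.perm_iff_count.2 hc).eq_of_pairwise (fun _ _ _ _ => le_antisymm) h h'

/-! ### Building good words -/

theorem IsGood.cons_doubled {n k : ℕ} {C : List ℕ} (hk : k ≤ n) (hC : IsGood k C) :
    IsGood (n + 1) (n :: (doubled k (n - k) ++ n :: C)) := by
  constructor
  · intro v
    have := hC.1 v
    simp only [List.count_cons, List.count_append, count_doubled, beq_iff_eq, this]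
    grind
  · have : n :: (doubled k (n - k) ++ n :: C) = (n :: (doubled k (n - k) ++ [n])) ++ C := by simp
    rw [this]
    refine (AvoidsAll.cons_of_pairwise ?_ ?_).append hC.2 ?_
    · simp only [List.pairwise_append, pairwise_doubled, mem_doubled]
      grind
    · simp only [List.mem_append, mem_doubled]
      grind
    · simp only [List.mem_append, List.mem_cons, mem_doubled, hC.mem_iff]
      grind

theorem IsGood.doubled_append {n k : ℕ} {C : List ℕ} (hk : k < n) (hC : IsGood k C) :
    IsGood (n + 1) (doubled k (n - k) ++ n :: n :: C) := by
  constructor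
  · intro v
    have := hC.1 v
    simp only [List.count_cons, List.count_append, count_doubled, beq_iff_eq, this]
    grind
  · have : doubled k (n - k) ++ n :: n :: C = (doubled k (n - k) ++ [n, n]) ++ C := by simp
    rw [this]
    refine (AvoidsAll.of_pairwise ?_).append hC.2 ?_
    · simp only [List.pairwise_append, pairwise_doubled, mem_doubled]
      grind
    · simp only [List.mem_append, List.mem_cons, mem_doubled, hC.mem_iff]
      grind

theorem IsGood.insert_doubled {n k : ℕ} {C : List ℕ} (hk : k < n) (hC : IsGood (k + 1) (k :: C)) :
    IsGood (n + 1) (k :: doubled (k + 1) (n - (k + 1)) ++ n :: n :: C) := by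
  constructor
  · intro v
    have := hC.1 v
    simp only [List.count_cons, List.count_append, count_doubled, beq_iff_eq] at this ⊢
    grind
  · have : k :: doubled (k + 1) (n - (k + 1)) ++ n :: n :: C =
      k :: ((doubled (k + 1) (n - (k + 1)) ++ [n, n]) ++ C) := by simp
    rw [this]
    refine AvoidsAll.insert_after_head ?_ hC.2 ?_ ?_
    · simp only [List.pairwise_append, pairwise_doubled, mem_doubled]
      grind
    · simp only [List.mem_append, mem_doubled]
      grind
    · intro c hc
      have := hC.mem_iff.1 (List.mem_cons_of_mem k hc)
      omega

/-! ### Decomposing good words at the two occurrences of the largest letter -/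

theorem exists_split {n : ℕ} {l : List ℕ} (h : IsGood (n + 1) l) :
    ∃ A B C, l = A ++ n :: (B ++ n :: C) ∧ n ∉ A ∧ n ∉ B ∧ n ∉ C := by
  obtain ⟨A, R, rfl, hA⟩ := List.eq_append_cons_of_mem (h.mem_iff.2 n.lt_succ_self)
  have hc := h.1 n
  have hR : n ∈ R := by
    rw [← List.count_pos_iff]
    simp [List.count_eq_zero_of_not_mem hA] at hc
    omega
  obtain ⟨B, C, rfl, hB⟩ := List.eq_append_cons_of_mem hR
  refine ⟨A, B, C, rfl, hA, hB, ?_⟩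
  rw [← List.count_eq_zero]
  simp [List.count_eq_zero_of_not_mem hA, List.count_eq_zero_of_not_mem hB] at hc
  omega

section Decompose

variable {n : ℕ} {A B C : List ℕ} (h : IsGood (n + 1) (A ++ n :: (B ++ n :: C)))
  (hA : n ∉ A) (hB : n ∉ B) (hC : n ∉ C)

include h

theorem count_split {v : ℕ} (hv : v ≠ n) :
    A.count v + B.count v + C.count v = if v < n then 2 else 0 := by
  have := h.1 v
  simp only [List.count_append, List.count_cons, beq_iff_eq, hv.symm] at this
  grind

theorem lt_of_mem_split {v : ℕ} (hv : v ≠ n) (hm : v ∈ A ∨ v ∈ B ∨ v ∈ C) : v < n := by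
  have := h.mem_iff.1 (show v ∈ A ++ n :: (B ++ n :: C) by simp; tauto)
  omega

include hA hB in
theorem pairwise_split : (A ++ B).Pairwise (· ≤ ·) := by
  rw [List.pairwise_iff_forall_sublist]
  intro a b hab
  by_contra! hlt
  have ha : a < n := by
    have : a ∈ A ++ B := hab.subset (by simp)
    rw [List.mem_append] at this
    exact lt_of_mem_split h (by rintro rfl; tauto) (by tauto)
  refine h.2.no213 b a n hlt ha ?_
  have h₁ : ([a, b] ++ [n]).Sublist ((A ++ B) ++ n :: C) := hab.append (by simp)
  refine h₁.trans ?_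
  simp only [List.append_assoc]
  exact (List.Sublist.refl A).append (List.sublist_cons_self n _)

include hA hB hC in
theorem le_of_mem_left {a b : ℕ} (ha : a ∈ A) (hb : b ∈ B ∨ b ∈ C) : b ≤ a := by
  by_contra! hlt
  have hb' : b < n := lt_of_mem_split h (by rintro rfl; tauto) (by tauto)
  refine h.2.no132 a b n hlt hb' ?_
  have h₁ : ([n, b]).Sublist (n :: (B ++ n :: C)) := by
    simp
    tauto
  exact (List.singleton_sublist.2 ha).append h₁

include hB hC in
theorem le_of_mem_mid {b c : ℕ} (hb : b ∈ B) (hc : c ∈ C) : c ≤ b := by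
  by_contra! hlt
  have hc' : c < n := lt_of_mem_split h (by rintro rfl; tauto) (by tauto)
  refine h.2.no132 b c n hlt hc' ?_
  have h₁ : ([n, c]).Sublist (n :: C) := by simpa
  exact (((List.singleton_sublist.2 hb).append h₁).cons n).trans (List.sublist_append_right A _)

include hB in
theorem notMem_right_of_mem_mid {b : ℕ} (hb : b ∈ B) : b ∉ C := by
  intro hc
  refine h.2.nocross n b (by rintro rfl; exact hB hb) ?_
  have h₁ : ([n, b]).Sublist (n :: C) := by simpa
  exact (((List.singleton_sublist.2 hb).append h₁).cons_cons n).trans (List.sublist_append_right A _)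

include hB in
theorem notMem_mid_of_mem_left {b : ℕ} (ha : b ∈ A) : b ∉ B := by
  intro hb
  refine h.2.nocross b n (by rintro rfl; exact hB hb) ?_
  have h₁ : ([b, n]).Sublist (B ++ n :: C) :=
    (List.singleton_sublist.2 hb).append (by simp)
  exact (List.singleton_sublist.2 ha).append (h₁.cons_cons n)

include hA hB hC in
theorem mid_eq_nil_of_left_ne_nil (hne : A ≠ []) : B = [] := by
  obtain ⟨a, ha⟩ := List.exists_mem_of_ne_nil A hne
  refine List.eq_nil_iff_forall_not_mem.2 fun b hb => ?_
  have h₁ := le_of_mem_left h hA hB hC ha (Or.inl hb)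
  have h₂ := (List.pairwise_append.1 (pairwise_split h hA hB)).2.2 a ha b hb
  obtain rfl := le_antisymm h₁ h₂
  exact notMem_mid_of_mem_left h hB ha hb

include hA hB hC in
theorem exists_mem_right_iff : ∃ k ≤ n, ∀ v, v ∈ C ↔ v < k := by
  classical
  have hex : ∃ k, k ∉ C := ⟨n, hC⟩
  have hdown : ∀ v w, v ∈ C → w < v → w ∈ C := fun v w hv hw => by
    have hvn := lt_of_mem_split h (fun e => hC (e ▸ hv)) (Or.inr (Or.inr hv))
    have hcount := count_split h (hw.trans hvn).ne
    have hwA : w ∉ A := fun hwA => by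
      have := le_of_mem_left h hA hB hC hwA (Or.inr hv)
      omega
    have hwB : w ∉ B := fun hwB => by
      have := le_of_mem_mid h hB hC hwB hv
      omega
    rw [List.count_eq_zero_of_not_mem hwA, List.count_eq_zero_of_not_mem hwB,
      if_pos (hw.trans hvn)] at hcount
    exact List.count_pos_iff.1 (by omega)
  refine ⟨Nat.find hex, Nat.find_min' hex hC, fun v => ⟨fun hv => ?_, fun hv => ?_⟩⟩
  · by_contra! hle
    rcases hle.eq_or_lt with e | hlt
    · exact Nat.find_spec hex (e ▸ hv)
    · exact Nat.find_spec hex (hdown v _ hv hlt)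
  · exact not_not.1 (Nat.find_min hex hv)

end Decompose

theorem IsGood.exists_of_cons {n : ℕ} {R : List ℕ} (h : IsGood (n + 1) (n :: R)) :
    ∃ k ≤ n, ∃ C, IsGood k C ∧ R = doubled k (n - k) ++ n :: C := by
  obtain ⟨B, C, rfl, hB, hC⟩ : ∃ B C, R = B ++ n :: C ∧ n ∉ B ∧ n ∉ C := by
    obtain ⟨A, B, C, e, hA, hB, hC⟩ := exists_split h
    rcases A with _ | ⟨a, A⟩ <;> grind
  have hA : n ∉ ([] : List ℕ) := by simp
  obtain ⟨k, hk, hmem⟩ := exists_mem_right_iff (A := []) h hA hB hC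
  have hcount : ∀ v, C.count v = if v < k then 2 else 0 := fun v => by
    by_cases hv : v < k
    · have hvC := (hmem v).2 hv
      have hvB : v ∉ B := fun hb => notMem_right_of_mem_mid (A := []) h hB hb hvC
      have := count_split (A := []) h (hv.trans_le hk).ne
      simp [List.count_eq_zero_of_not_mem hvB] at this
      grind
    · rw [List.count_eq_zero_of_not_mem (by rwa [hmem]), if_neg hv]
  refine ⟨k, hk, C, ⟨hcount, h.2.sublist ?_⟩, ?_⟩
  · exact (List.sublist_cons_self n C).trans
      ((List.sublist_append_right B _).trans (List.sublist_cons_self n _))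
  · congr 1
    refine eq_of_pairwise_of_count (pairwise_split (A := []) h hA hB) (pairwise_doubled _ _)
      fun v => ?_
    rw [count_doubled]
    by_cases hv : v = n
    · subst hv
      rw [List.count_eq_zero_of_not_mem hB]
      grind
    · have := count_split (A := []) h hv
      simp [hcount] at this
      grind

theorem IsGood.exists_of_head_ne {n : ℕ} {A B C : List ℕ}
    (h : IsGood (n + 1) (A ++ n :: (B ++ n :: C))) (hA : n ∉ A) (hB : n ∉ B) (hC : n ∉ C)
    (hne : A ≠ []) :
    B = [] ∧ ∃ k < n, (IsGood k C ∧ A = doubled k (n - k)) ∨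
      (IsGood (k + 1) (k :: C) ∧ A = k :: doubled (k + 1) (n - (k + 1))) := by
  have hnil := mid_eq_nil_of_left_ne_nil h hA hB hC hne
  refine ⟨hnil, ?_⟩
  obtain ⟨k, hk, hmem⟩ := exists_mem_right_iff h hA hB hC
  subst hnil
  have hsum := fun v (hv : v ≠ n) => count_split h hv
  simp only [List.count_nil, add_zero] at hsum
  have hsorted := pairwise_split h hA hB
  rw [List.append_nil] at hsorted
  have hCk : ∀ v, k ≤ v → C.count v = 0 := fun v hv =>
    List.count_eq_zero_of_not_mem (by rw [hmem]; omega)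
  have hAn : A.count n = 0 := List.count_eq_zero_of_not_mem hA
  have hAlow : ∀ v, v + 1 < k → A.count v = 0 := fun v hv =>
    List.count_eq_zero_of_not_mem fun hvA => by
      have := le_of_mem_left h hA hB hC hvA (Or.inr ((hmem (v + 1)).2 hv))
      omega
  have havoid : AvoidsAll (A ++ C) := h.2.sublist <|
    (List.Sublist.refl A).append (((List.sublist_cons_self n C).trans (List.sublist_cons_self n _)))
  by_cases hlast : ∃ j, k = j + 1 ∧ j ∈ A
  · obtain ⟨j, rfl, hj⟩ := hlast
    have hjA := List.count_pos_iff.2 hj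
    have hjC := List.count_pos_iff.2 ((hmem j).2 j.lt_succ_self)
    have hjsum := hsum j (by omega)
    refine ⟨j, hk, Or.inr ⟨⟨fun v => ?_, havoid.sublist ?_⟩, ?_⟩⟩
    · have := hsum v
      have := hCk v
      have := hAlow v
      simp only [List.count_cons, beq_iff_eq]
      grind
    · exact (List.singleton_sublist.2 hj).append (List.Sublist.refl C)
    · refine eq_of_pairwise_of_count hsorted ?_ fun v => ?_
      · simp only [List.pairwise_cons, pairwise_doubled, mem_doubled]
        grind
      · have := hsum v
        have := hCk v
        have := hAlow v
        simp only [List.count_cons, beq_iff_eq, count_doubled]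
        grind
  · have hAlow' : ∀ v, v < k → A.count v = 0 := fun v hv => by
      rcases (show v + 1 ≤ k from hv).lt_or_eq with hlt | e
      · exact hAlow v hlt
      · exact List.count_eq_zero_of_not_mem fun hvA => hlast ⟨v, e.symm, hvA⟩
    have hA' : A = doubled k (n - k) :=
      eq_of_pairwise_of_count hsorted (pairwise_doubled _ _) fun v => by
        have := hsum v
        have := hCk v
        have := hAlow' v
        rw [count_doubled]
        grind
    refine ⟨k, hk.lt_of_ne ?_, Or.inl ⟨⟨fun v => ?_, havoid.sublist ?_⟩, hA'⟩⟩
    · intro e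
      rw [e, Nat.sub_self] at hA'
      exact hne hA'
    · have := hsum v
      have := hCk v
      have := hAlow' v
      grind
    · exact List.sublist_append_right A C

/-! ### Encoding functions as words -/

theorem sublist_ofFn_iff {α : Type*} {m : ℕ} {f : Fin m → α} {l : List α} :
    l.Sublist (List.ofFn f) ↔ ∃ l' : List (Fin m), l'.Pairwise (· < ·) ∧ l = l'.map f := by
  rw [List.ofFn_eq_map, List.sublist_map_iff]
  refine exists_congr fun l' => and_congr_left' ⟨fun h => ?_, fun h => ?_⟩
  · exact (List.pairwise_lt_finRange m).sublist h
  · exact List.sublist_of_subperm_of_pairwise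
      (List.subperm_of_subset h.nodup fun _ _ => List.mem_finRange _) h (List.pairwise_lt_finRange m)

theorem three_sublist_ofFn {α : Type*} {m : ℕ} {f : Fin m → α} {a b c : α} :
    [a, b, c].Sublist (List.ofFn f) ↔
      ∃ i j k, i < j ∧ j < k ∧ f i = a ∧ f j = b ∧ f k = c := by
  rw [sublist_ofFn_iff]
  constructor
  · rintro ⟨_ | ⟨i, _ | ⟨j, _ | ⟨k, _ | ⟨x, l⟩⟩⟩⟩, h, e⟩ <;> simp at e
    simp at h
    exact ⟨i, j, k, h.1.1, h.2, e.1.symm, e.2.1.symm, e.2.2.symm⟩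
  · rintro ⟨i, j, k, hij, hjk, rfl, rfl, rfl⟩
    exact ⟨[i, j, k], by simp [hij, hjk, hij.trans hjk], rfl⟩

theorem four_sublist_ofFn {α : Type*} {m : ℕ} {f : Fin m → α} {a b c d : α} :
    [a, b, c, d].Sublist (List.ofFn f) ↔
      ∃ i j k l, i < j ∧ j < k ∧ k < l ∧ f i = a ∧ f j = b ∧ f k = c ∧ f l = d := by
  rw [sublist_ofFn_iff]
  constructor
  · rintro ⟨_ | ⟨i, _ | ⟨j, _ | ⟨k, _ | ⟨l, _ | ⟨x, t⟩⟩⟩⟩⟩, h, e⟩ <;> simp at e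
    simp at h
    exact ⟨i, j, k, l, h.1.1, h.2.1.1, h.2.2, e.1.symm, e.2.1.symm, e.2.2.1.symm, e.2.2.2.symm⟩
  · rintro ⟨i, j, k, l, hij, hjk, hkl, rfl, rfl, rfl, rfl⟩
    exact ⟨[i, j, k, l], by
      simp [hij, hjk, hkl, hij.trans hjk, hjk.trans hkl, (hij.trans hjk).trans hkl], rfl⟩

theorem count_ofFn {α : Type*} [DecidableEq α] {m : ℕ} (f : Fin m → α) (v : α) :
    (List.ofFn f).count v = Nat.card {i // f i = v} := by
  have h := (List.nodup_finRange m).card_eq_countP (P := fun i => f i = v)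
  rw [List.toFinset_finRange] at h
  rw [List.ofFn_eq_map, List.count, List.countP_map, Nat.card_eq_fintype_card,
    Fintype.card_subtype, h]
  rfl

/-- The word of values of `π`. -/
def toWord {n : ℕ} (π : Fin (2 * n) → Fin n) : List ℕ := List.ofFn fun i => (π i : ℕ)

theorem count_toWord {n : ℕ} (π : Fin (2 * n) → Fin n) (v : Fin n) :
    (toWord π).count (v : ℕ) = Nat.card {i // π i = v} := by
  rw [toWord, count_ofFn]
  simp only [Fin.val_inj]

theorem isMultisetPerm_iff {n : ℕ} (π : Fin (2 * n) → Fin n) :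
    IsMultisetPerm n π ↔ ∀ v, (toWord π).count v = if v < n then 2 else 0 := by
  constructor
  · intro h v
    split_ifs with hv
    · exact (count_toWord π ⟨v, hv⟩).trans (h ⟨v, hv⟩)
    · refine List.count_eq_zero_of_not_mem fun hm => hv ?_
      obtain ⟨i, rfl⟩ := List.mem_ofFn.1 hm
      exact (π i).2
  · intro h v
    rw [← count_toWord, h, if_pos v.2]

theorem avoids_cross_iff {n : ℕ} (π : Fin (2 * n) → Fin n) :
    Avoids1212 n π ∧ Avoids2121 n π ↔ ∀ a b, a ≠ b → ¬ [a, b, a, b].Sublist (toWord π) := by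
  simp only [toWord, four_sublist_ofFn]
  constructor
  · rintro ⟨h₁, h₂⟩ a b hab ⟨i, j, k, l, hij, hjk, hkl, hi, hj, hk, hl⟩
    have hik : π i = π k := Fin.ext (hi.trans hk.symm)
    have hjl : π j = π l := Fin.ext (hj.trans hl.symm)
    rcases hab.lt_or_gt with hlt | hlt
    · exact h₁ ⟨i, j, k, l, hij, hjk, hkl, hik, hjl, by rw [Fin.lt_def]; omega⟩
    · exact h₂ ⟨i, j, k, l, hij, hjk, hkl, hik, hjl, by rw [Fin.lt_def]; omega⟩
  · intro h
    constructor <;> rintro ⟨i, j, k, l, hij, hjk, hkl, hik, hjl, hlt⟩ <;>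
      refine h (π i) (π j) (by rw [Fin.lt_def] at hlt; omega)
        ⟨i, j, k, l, hij, hjk, hkl, rfl, rfl, by rw [hik], by rw [hjl]⟩

theorem contains3_iff {n : ℕ} (σ : Fin 3 → ℕ) (π : Fin (2 * n) → Fin n) :
    Contains3 n σ π ↔ ∃ i j k, i < j ∧ j < k ∧
      ∀ a b : Fin 3, ![π i, π j, π k] a < ![π i, π j, π k] b ↔ σ a < σ b := by
  constructor
  · rintro ⟨f, hf, h⟩
    refine ⟨f 0, f 1, f 2, hf (by decide), hf (by decide), ?_⟩
    have e : ![π (f 0), π (f 1), π (f 2)] = π ∘ f := by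
      funext a
      fin_cases a <;> rfl
    simpa only [e, Function.comp_apply] using h
  · rintro ⟨i, j, k, hij, hjk, h⟩
    refine ⟨![i, j, k], Fin.strictMono_iff_lt_succ.2 ?_, ?_⟩
    · intro a
      fin_cases a <;> simpa
    · have e : ![π i, π j, π k] = π ∘ ![i, j, k] := by
        funext a
        fin_cases a <;> rfl
      simpa only [e, Function.comp_apply] using h

theorem avoids132_iff {n : ℕ} (π : Fin (2 * n) → Fin n) :
    Avoids3 n ![1, 3, 2] π ↔ ∀ a b c, a < b → b < c → ¬ [a, c, b].Sublist (toWord π) := by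
  rw [Avoids3, contains3_iff]
  simp only [toWord, three_sublist_ofFn]
  constructor
  · rintro h _ _ _ h₁ h₂ ⟨i, j, k, hij, hjk, rfl, rfl, rfl⟩
    refine h ⟨i, j, k, hij, hjk, ?_⟩
    simp only [Fin.forall_fin_succ, Fin.lt_def]
    simp
    omega
  · rintro h ⟨i, j, k, hij, hjk, hσ⟩
    have h₁ := (hσ 0 2).2 (by simp)
    have h₂ := (hσ 2 1).2 (by simp)
    exact h _ _ _ h₁ h₂ ⟨i, j, k, hij, hjk, rfl, rfl, rfl⟩

theorem avoids213_iff {n : ℕ} (π : Fin (2 * n) → Fin n) :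
    Avoids3 n ![2, 1, 3] π ↔ ∀ a b c, a < b → b < c → ¬ [b, a, c].Sublist (toWord π) := by
  rw [Avoids3, contains3_iff]
  simp only [toWord, three_sublist_ofFn]
  constructor
  · rintro h _ _ _ h₁ h₂ ⟨i, j, k, hij, hjk, rfl, rfl, rfl⟩
    refine h ⟨i, j, k, hij, hjk, ?_⟩
    simp only [Fin.forall_fin_succ, Fin.lt_def]
    simp
    omega
  · rintro h ⟨i, j, k, hij, hjk, hσ⟩
    have h₁ := (hσ 1 0).2 (by simp)
    have h₂ := (hσ 0 2).2 (by simp)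
    exact h _ _ _ h₁ h₂ ⟨i, j, k, hij, hjk, rfl, rfl, rfl⟩

theorem isGood_toWord_iff {n : ℕ} (π : Fin (2 * n) → Fin n) :
    IsGood n (toWord π) ↔
      IsQuasiStirling n π ∧ Avoids3 n ![1, 3, 2] π ∧ Avoids3 n ![2, 1, 3] π := by
  rw [IsQuasiStirling, isMultisetPerm_iff, avoids_cross_iff, avoids132_iff, avoids213_iff]
  exact ⟨fun ⟨h, h₁, h₂, h₃⟩ => ⟨⟨h, h₃⟩, h₁, h₂⟩, fun ⟨⟨h, h₃⟩, h₁, h₂⟩ => ⟨h, h₁, h₂, h₃⟩⟩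

theorem toWord_injective (n : ℕ) : Function.Injective (toWord (n := n)) := fun π π' h => by
  funext i
  exact Fin.ext (congrFun (List.ofFn_injective h) i)

theorem IsGood.exists_toWord_eq {n : ℕ} {l : List ℕ} (h : IsGood n l) :
    ∃ π : Fin (2 * n) → Fin n, toWord π = l := by
  have hlen := h.length_eq
  refine ⟨fun i => ⟨l[i], h.mem_iff.1 (List.getElem_mem _)⟩, ?_⟩
  refine List.ext_getElem ?_ fun i h₁ h₂ => ?_
  · simp [toWord, hlen]
  · simp [toWord]

/-! ### Counting good words -/

theorem append_cons_inj_of_notMem {α : Type*} {a : α} {A A' R R' : List α} (hA : a ∉ A)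
    (hA' : a ∉ A') (h : A ++ a :: R = A' ++ a :: R') : A = A' ∧ R = R' := by
  induction A generalizing A' with
  | nil => cases A' <;> simp_all
  | cons x A ih =>
    cases A' with
    | nil => exact absurd (List.cons.inj h).1.symm (List.ne_of_not_mem_cons hA)
    | cons y A' =>
      simp only [List.cons_append, List.cons.injEq, List.mem_cons, not_or] at hA hA' h ⊢
      obtain ⟨rfl, rfl⟩ := ih hA.2 hA'.2 h.2
      exact ⟨⟨h.1, rfl⟩, rfl⟩

/-- Good words on `0, …, n - 1`. -/
abbrev GoodWord (n : ℕ) : Type := {l : List ℕ // IsGood n l}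

/-- Tails of the good words on `0, …, n` that start with `n`. -/
abbrev GoodTail (n : ℕ) : Type := {l : List ℕ // IsGood (n + 1) (n :: l)}

theorem notMem_doubled_sub {n k : ℕ} (hk : k ≤ n) : n ∉ doubled k (n - k) := by
  rw [mem_doubled]
  omega

/-- The tail `k k ⋯ (n-1) (n-1) n C` attached to a good word `C` on `0, …, k - 1`. -/
def tailOfWord (n : ℕ) (x : Σ k : Fin (n + 1), GoodWord k) : GoodTail n :=
  ⟨doubled x.1 (n - x.1) ++ n :: x.2.1, IsGood.cons_doubled (Nat.le_of_lt_succ x.1.2) x.2.2⟩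

theorem tailOfWord_bijective (n : ℕ) : Function.Bijective (tailOfWord n) := by
  constructor
  · rintro ⟨⟨k, hk⟩, C, hC⟩ ⟨⟨k', hk'⟩, C', hC'⟩ e
    obtain ⟨-, rfl⟩ := append_cons_inj_of_notMem (notMem_doubled_sub (Nat.le_of_lt_succ hk))
      (notMem_doubled_sub (Nat.le_of_lt_succ hk')) (congrArg Subtype.val e)
    obtain rfl : k = k' := by
      have := hC.length_eq
      have := hC'.length_eq
      dsimp only at *
      omega
    rfl
  · rintro ⟨R, hR⟩
    obtain ⟨k, hk, C, hC, rfl⟩ := hR.exists_of_cons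
    exact ⟨⟨⟨k, Nat.lt_succ_of_le hk⟩, C, hC⟩, rfl⟩

/-- The three ways of building a good word on `0, …, n`. -/
def wordOfSum (n : ℕ) :
    GoodTail n ⊕ (Σ k : Fin n, GoodWord k) ⊕ (Σ k : Fin n, GoodTail k) → GoodWord (n + 1)
  | .inl x => ⟨n :: x.1, x.2⟩
  | .inr (.inl x) => ⟨doubled x.1 (n - x.1) ++ n :: n :: x.2.1, x.2.2.doubled_append x.1.2⟩
  | .inr (.inr x) => ⟨(x.1 : ℕ) :: doubled (x.1 + 1) (n - (x.1 + 1)) ++ n :: n :: x.2.1,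
      x.2.2.insert_doubled x.1.2⟩

theorem notMem_cons_doubled {n k : ℕ} (hk : k < n) :
    n ∉ k :: doubled (k + 1) (n - (k + 1)) := by
  rw [List.mem_cons, mem_doubled]
  omega

theorem doubled_ne_cons_doubled (k m k' m' : ℕ) : doubled k m ≠ k' :: doubled (k' + 1) m' :=
  fun e => by
    have := congrArg List.length e
    rw [List.length_cons, length_doubled, length_doubled] at this
    omega

theorem wordOfSum_injective (n : ℕ) : Function.Injective (wordOfSum n) := by
  have hnil : n ∉ ([] : List ℕ) := by simp
  rintro (⟨R, hR⟩ | ⟨⟨k, hk⟩, C, hC⟩ | ⟨⟨k, hk⟩, C, hC⟩)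
    (⟨R', hR'⟩ | ⟨⟨k', hk'⟩, C', hC'⟩ | ⟨⟨k', hk'⟩, C', hC'⟩) e <;>
  replace e := Subtype.mk.inj e
  · simp_all
  · have := congrArg List.length (append_cons_inj_of_notMem hnil (notMem_doubled_sub hk'.le) e).1
    rw [length_doubled, List.length_nil] at this
    omega
  · have := (append_cons_inj_of_notMem hnil (notMem_cons_doubled hk') e).1
    simp at this
  · have := congrArg List.length (append_cons_inj_of_notMem (notMem_doubled_sub hk.le) hnil e).1
    rw [length_doubled, List.length_nil] at this
    omega
  · obtain ⟨-, e⟩ := append_cons_inj_of_notMem (notMem_doubled_sub hk.le)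
      (notMem_doubled_sub hk'.le) e
    obtain rfl : C = C' := by simpa using e
    obtain rfl : k = k' := by
      have := hC.length_eq
      have := hC'.length_eq
      dsimp only at *
      omega
    rfl
  · exact absurd (append_cons_inj_of_notMem (notMem_doubled_sub hk.le)
      (notMem_cons_doubled hk') e).1 (doubled_ne_cons_doubled _ _ _ _)
  · have := (append_cons_inj_of_notMem (notMem_cons_doubled hk) hnil e).1
    simp at this
  · exact absurd (append_cons_inj_of_notMem (notMem_cons_doubled hk) (notMem_doubled_sub hk'.le)
      e).1.symm (doubled_ne_cons_doubled _ _ _ _)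
  · obtain ⟨e₁, e₂⟩ := append_cons_inj_of_notMem (notMem_cons_doubled hk)
      (notMem_cons_doubled hk') e
    obtain rfl : C = C' := by simpa using e₂
    obtain rfl : k = k' := (List.cons.inj e₁).1
    rfl

theorem wordOfSum_surjective (n : ℕ) : Function.Surjective (wordOfSum n) := by
  rintro ⟨l, hl⟩
  obtain ⟨A, B, C, rfl, hA, hB, hC⟩ := exists_split hl
  by_cases hne : A = []
  · subst hne
    exact ⟨.inl ⟨_, hl⟩, rfl⟩
  · obtain ⟨rfl, k, hk, ⟨hC, rfl⟩ | ⟨hC, rfl⟩⟩ := hl.exists_of_head_ne hA hB hC hne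
    · exact ⟨.inr (.inl ⟨⟨k, hk⟩, C, hC⟩), rfl⟩
    · exact ⟨.inr (.inr ⟨⟨k, hk⟩, C, hC⟩), Subtype.ext rfl⟩

theorem toWord_bijective (n : ℕ) : Function.Bijective
    fun π : {π : Fin (2 * n) → Fin n //
        IsQuasiStirling n π ∧ Avoids3 n ![1, 3, 2] π ∧ Avoids3 n ![2, 1, 3] π} =>
      (⟨toWord π.1, (isGood_toWord_iff π.1).2 π.2⟩ : GoodWord n) := by
  constructor
  · intro π π' h
    exact Subtype.ext (toWord_injective n (congrArg Subtype.val h))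
  · rintro ⟨l, hl⟩
    obtain ⟨π, rfl⟩ := hl.exists_toWord_eq
    exact ⟨⟨π, (isGood_toWord_iff π).1 hl⟩, rfl⟩

theorem qbar132213_eq_card_goodWord (n : ℕ) : qbar132213 n = Nat.card (GoodWord n) :=
  Nat.card_eq_of_bijective _ (toWord_bijective n)

instance (n : ℕ) : Finite (GoodWord n) :=
  Finite.of_surjective _ (toWord_bijective n).2

theorem card_goodTail (n : ℕ) :
    Nat.card (GoodTail n) = ∑ k ∈ Finset.range (n + 1), Nat.card (GoodWord k) := by
  rw [← Nat.card_eq_of_bijective _ (tailOfWord_bijective n), Nat.card_sigma,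
    ← Fin.sum_univ_eq_sum_range]

instance (n : ℕ) : Finite (GoodTail n) :=
  Finite.of_surjective _ (tailOfWord_bijective n).2

theorem card_goodWord_succ (n : ℕ) :
    Nat.card (GoodWord (n + 1)) = Nat.card (GoodTail n) +
      ((∑ k ∈ Finset.range n, Nat.card (GoodWord k)) +
        ∑ k ∈ Finset.range n, Nat.card (GoodTail k)) := by
  rw [← Nat.card_eq_of_bijective _ ⟨wordOfSum_injective n, wordOfSum_surjective n⟩, Nat.card_sum,
    Nat.card_sum, Nat.card_sigma, Nat.card_sigma,
    Fin.sum_univ_eq_sum_range (fun k => Nat.card (GoodWord k)),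
    Fin.sum_univ_eq_sum_range (fun k => Nat.card (GoodTail k))]

theorem card_goodWord_zero : Nat.card (GoodWord 0) = 1 := by
  rw [Nat.card_eq_one_iff_exists]
  refine ⟨⟨[], fun v => by simp, AvoidsAll.of_pairwise .nil⟩, fun ⟨l, hl⟩ => Subtype.ext ?_⟩
  have := hl.length_eq
  simpa using this


theorem card_goodTail_succ (n : ℕ) :
    Nat.card (GoodTail (n + 1)) = Nat.card (GoodTail n) + Nat.card (GoodWord (n + 1)) := by
  rw [card_goodTail, Finset.sum_range_succ, ← card_goodTail]

theorem card_goodWord_add_two (n : ℕ) :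
    Nat.card (GoodWord (n + 2)) =
      Nat.card (GoodTail n) + 2 * Nat.card (GoodWord (n + 1)) + Nat.card (GoodWord n) := by
  have h₁ : Nat.card (GoodWord (n + 2)) = _ := card_goodWord_succ (n + 1)
  have h₂ := card_goodWord_succ n
  rw [Finset.sum_range_succ, Finset.sum_range_succ, card_goodTail_succ] at h₁
  omega

theorem quasiStirling_avoiding_132_213 :
    qbar132213 1 = 1 ∧ qbar132213 2 = 4 ∧ qbar132213 3 = 11 ∧
      ∀ n : ℕ, 4 ≤ n →
        qbar132213 n + qbar132213 (n - 3) = 3 * qbar132213 (n - 1) := by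
  simp only [qbar132213_eq_card_goodWord]
  have h₀ := card_goodWord_zero
  have ht : Nat.card (GoodTail 0) = 1 := by
    rw [card_goodTail]
    simp [h₀]
  have h₁ : Nat.card (GoodWord 1) = 1 := by
    rw [card_goodWord_succ]
    simp [ht]
  have h₂ : Nat.card (GoodWord 2) = 4 := by
    rw [card_goodWord_add_two, ht, h₁, h₀]
  have h₃ : Nat.card (GoodWord 3) = 11 := by
    rw [card_goodWord_add_two, card_goodTail_succ, ht, h₂, h₁]
  refine ⟨h₁, h₂, h₃, fun n hn => ?_⟩
  obtain ⟨m, rfl⟩ := Nat.exists_eq_add_of_le' hn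
  change Nat.card (GoodWord (m + 4)) + Nat.card (GoodWord (m + 1)) =
    3 * Nat.card (GoodWord (m + 3))
  have e₁ : Nat.card (GoodWord (m + 4)) = _ + 2 * Nat.card (GoodWord (m + 3)) + _ :=
    card_goodWord_add_two (m + 2)
  have e₂ : Nat.card (GoodWord (m + 3)) = _ + 2 * Nat.card (GoodWord (m + 2)) + _ :=
    card_goodWord_add_two (m + 1)
  have e₃ : Nat.card (GoodTail (m + 2)) = _ + Nat.card (GoodWord (m + 2)) :=
    card_goodTail_succ (m + 1)
  omega
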